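/- Let K be a field and let φ : K[x_{1,i}, x_{2,i} : i ≥ 1] → K[x_i : i ≥ 1] be the K-algebra homomorphism with φ(x_{1,i}) = x_i x_{i+1} and φ(x_{2,i}) = x_i x_{i+2}, and let I = ker φ. For k ≥ 0 let sh_k be the K-algebra endomorphism of K[x_{1,i}, x_{2,i} : i ≥ 1] with sh_k(x_{1,i}) = x_{1,i+k} and sh_k(x_{2,i}) = x_{2,i+k}. Then I is not finitely generated up to shift: there is no finite subset F ⊆ I such that I equals the ideal generated by {sh_k(f) : f ∈ F, k ≥ 0}. -/

import Mathlib

open MvPolynomial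

/-- The toric map `φ : K[x_{1,i}, x_{2,i} : i ≥ 1] → K[x_i : i ≥ 1]` with
`φ(x_{1,i}) = x_i x_{i+1}` and `φ(x_{2,i}) = x_i x_{i+2}`.  The variable `x_{j,i}` is
indexed by the pair `(j-1, i) : Fin 2 × ℕ+`. -/
noncomputable def phi (K : Type*) [Field K] :
    MvPolynomial (Fin 2 × ℕ+) K →ₐ[K] MvPolynomial ℕ+ K :=
  aeval fun p : Fin 2 × ℕ+ => X p.2 * X (p.2 + if p.1 = 0 then 1 else 2)

/-- The shift endomorphism `sh_k` with `sh_k(x_{j,i}) = x_{j,i+k}`. -/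
noncomputable def sh (K : Type*) [Field K] (k : ℕ) :
    MvPolynomial (Fin 2 × ℕ+) K →ₐ[K] MvPolynomial (Fin 2 × ℕ+) K :=
  aeval fun p : Fin 2 × ℕ+ =>
    X (p.1, (⟨(p.2 : ℕ) + k, Nat.add_pos_left p.2.pos k⟩ : ℕ+))

/-- The exponent map of `phi`: the image of the monomial with exponent `v` has exponent
`expMap v`. -/
noncomputable def expMap : (Fin 2 × ℕ+ →₀ ℕ) →+ (ℕ+ →₀ ℕ) :=
  Finsupp.liftAddHom fun p : Fin 2 × ℕ+ =>
    Finsupp.singleAddHom p.2 + Finsupp.singleAddHom (p.2 + if p.1 = 0 then 1 else 2)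

/-- The exponent of `x_{j,n}` in `v`, extended by zero to `n = 0`. -/
def extendZero (v : Fin 2 × ℕ+ →₀ ℕ) (j : Fin 2) (n : ℕ) : ℕ :=
  if n = 0 then 0 else v (j, n.toPNat')

theorem extendZero_add (v w : Fin 2 × ℕ+ →₀ ℕ) (j : Fin 2) (n : ℕ) :
    extendZero (v + w) j n = extendZero v j n + extendZero w j n := by
  unfold extendZero; split_ifs <;> simp

theorem extendZero_coe (v : Fin 2 × ℕ+ →₀ ℕ) (j : Fin 2) (n : ℕ+) :
    extendZero v j n = v (j, n) := by
  simp [extendZero]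

theorem extendZero_single (j' : Fin 2) (i : ℕ+) (c : ℕ) (j : Fin 2) (n : ℕ) :
    extendZero (Finsupp.single (j', i) c) j n = if j' = j ∧ (i : ℕ) = n then c else 0 := by
  have hi := i.pos
  have h : n ≠ 0 → ((j', i) = (j, n.toPNat') ↔ j' = j ∧ (i : ℕ) = n) := by
    intro hn
    rw [Prod.mk.injEq, ← PNat.coe_inj, Nat.toPNat'_coe, if_pos (by omega)]
  unfold extendZero
  split_ifs with h1 h2 h2
  · omega
  · rfl
  · rw [Finsupp.single_apply, if_pos ((h h1).2 h2)]
  · rw [Finsupp.single_apply, if_neg (mt (h h1).1 h2)]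

theorem expMap_apply (v : Fin 2 × ℕ+ →₀ ℕ) (i : ℕ+) :
    expMap v i = extendZero v 0 i + extendZero v 1 i + extendZero v 0 (i - 1 : ℕ) +
      extendZero v 1 (i - 2 : ℕ) := by
  induction v using Finsupp.induction_linear with
  | zero => simp [extendZero]
  | add f g hf hg =>
    rw [map_add, Finsupp.add_apply, hf, hg]
    simp only [extendZero_add]
    ring
  | single p c =>
    obtain ⟨j, k⟩ := p
    have hk := k.pos
    have hi := i.pos
    simp only [extendZero_single, expMap, Finsupp.liftAddHom_apply_single, AddMonoidHom.add_apply,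
      Finsupp.singleAddHom_apply, Finsupp.add_apply, Finsupp.single_apply, ← PNat.coe_inj,
      PNat.add_coe]
    fin_cases j
    · simp
      split_ifs <;> omega
    · simp
      split_ifs <;> omega

theorem sh_eq_rename (K : Type*) [Field K] (k : ℕ) :
    sh K k = rename fun p : Fin 2 × ℕ+ => (p.1, ((p.2 : ℕ) + k).toPNat') := by
  refine algHom_ext fun p => ?_
  rw [rename_X, sh, aeval_X]
  congr 2
  exact PNat.eq ((Nat.toPNat'_coe _).trans (if_pos (Nat.add_pos_left p.2.pos k))).symm

theorem phi_monomial (K : Type*) [Field K] (v : Fin 2 × ℕ+ →₀ ℕ) (c : K) :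
    phi K (monomial v c) = monomial (expMap v) c := by
  have h : phi K (monomial v 1) = monomial (expMap v) 1 := by
    induction v using Finsupp.induction_linear with
    | zero => simp
    | add f g hf hg =>
      rw [map_add, ← one_mul (1 : K), ← monomial_mul, map_mul, hf, hg, monomial_mul]
    | single p n =>
      rw [← X_pow_eq_monomial, map_pow, expMap, Finsupp.liftAddHom_apply_single,
        AddMonoidHom.add_apply, Finsupp.singleAddHom_apply, Finsupp.singleAddHom_apply,
        ← one_mul (1 : K), ← monomial_mul, ← X_pow_eq_monomial, ← X_pow_eq_monomial, ← mul_pow,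
        phi, aeval_X]
  rw [← mul_one c, ← smul_eq_mul, ← smul_monomial, map_smul, h, smul_monomial]

theorem coeff_phi (K : Type*) [Field K] (h : MvPolynomial (Fin 2 × ℕ+) K) (e : ℕ+ →₀ ℕ) :
    coeff e (phi K h) = ∑ w ∈ h.support, if expMap w = e then coeff w h else 0 := by
  conv_lhs => rw [h.as_sum, map_sum, coeff_sum]
  simp only [phi_monomial, coeff_monomial]

/-- A monomial which is alone in its fibre of `expMap` among the monomials of an element of
`ker φ` does not occur in that element. -/
theorem coeff_eq_zero_of_mem_ker {K : Type*} [Field K] {h : MvPolynomial (Fin 2 × ℕ+) K}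
    (hh : phi K h = 0) (v : Fin 2 × ℕ+ →₀ ℕ)
    (hv : ∀ w ∈ h.support, expMap w = expMap v → w = v) : coeff v h = 0 := by
  by_contra hne
  have hs := coeff_phi K h (expMap v)
  rw [hh, coeff_zero, Finset.sum_eq_single v, if_pos rfl] at hs
  · exact hne hs.symm
  · intro w hw hwv
    exact if_neg fun he => hwv (hv w hw he)
  · intro hvs
    exact absurd (mem_support_iff.2 hne) hvs

/-- If the fibre of `m` consists of `m` and monomials coprime to `m`, and `m` does not occur in
`h ∈ ker φ`, then `m` does not occur in any multiple of `h`. -/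
theorem coeff_mul_eq_zero_of_mem_ker {K : Type*} [Field K] {h : MvPolynomial (Fin 2 × ℕ+) K}
    (hh : phi K h = 0) (m : Fin 2 × ℕ+ →₀ ℕ)
    (hm : ∀ w, expMap w = expMap m → w = m ∨ ∀ p, m p = 0 ∨ w p = 0)
    (hmh : coeff m h = 0) (q : MvPolynomial (Fin 2 × ℕ+) K) : coeff m (q * h) = 0 := by
  rw [coeff_mul]
  refine Finset.sum_eq_zero fun uv huv => ?_
  obtain ⟨u, v⟩ := uv
  rw [Finset.HasAntidiagonal.mem_antidiagonal] at huv
  dsimp only at huv ⊢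
  by_cases hu : u = 0
  · subst hu
    rw [zero_add] at huv
    rw [huv, hmh, mul_zero]
  · rw [coeff_eq_zero_of_mem_ker hh v, mul_zero]
    intro w _ hw
    rcases hm (u + w) (by rw [← huv, map_add, map_add, hw]) with h1 | h1
    · rw [← huv] at h1
      exact add_left_cancel h1
    · refine absurd (Finsupp.ext fun p => ?_) hu
      have := h1 p
      rw [← huv] at this
      simp only [Finsupp.add_apply, Finsupp.coe_zero, Pi.zero_apply] at this ⊢
      omega

/-- The exponent function of the monomial
`x_{1,1} x_{2,3}² x_{2,7}² ⋯ x_{2,4t-1}² x_{1,4t+2}`. -/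
def endEdges (t : ℕ) (j : Fin 2) (n : ℕ) : ℕ :=
  if j = 0 then if n = 1 ∨ n = 4 * t + 2 then 1 else 0
  else if n % 4 = 3 ∧ n < 4 * t + 1 then 2 else 0

/-- The exponent function of the monomial
`x_{1,2} x_{2,1} x_{2,5}² x_{2,9}² ⋯ x_{2,4t-3}² x_{1,4t+1} x_{2,4t+1}`. -/
def endCherries (t : ℕ) (j : Fin 2) (n : ℕ) : ℕ :=
  if j = 0 then if n = 2 ∨ n = 4 * t + 1 then 1 else 0
  else if n = 1 ∨ n = 4 * t + 1 then 1 else if n % 4 = 1 ∧ n < 4 * t + 1 then 2 else 0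

/-- The monomial with exponents `f j n`, cut off at `n = N`. -/
noncomputable def truncMonomial (N : ℕ) (f : Fin 2 → ℕ → ℕ) : Fin 2 × ℕ+ →₀ ℕ :=
  Finsupp.onFinset (Finset.univ ×ˢ Finset.Icc 1 (N.succPNat))
    (fun p => if (p.2 : ℕ) ≤ N then f p.1 p.2 else 0) (by
      rintro ⟨j, n⟩ h
      have : (n : ℕ) ≤ N := by
        by_contra h'
        simp [h'] at h
      simp only [Finset.mem_product, Finset.mem_univ, true_and, Finset.mem_Icc, one_le,
        ← PNat.coe_le_coe, Nat.succPNat_coe]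
      omega)

theorem extendZero_truncMonomial {N : ℕ} {f : Fin 2 → ℕ → ℕ} (h0 : ∀ j, f j 0 = 0)
    (hN : ∀ j n, N < n → f j n = 0) (j : Fin 2) (n : ℕ) :
    extendZero (truncMonomial N f) j n = f j n := by
  unfold extendZero truncMonomial
  split_ifs with h
  · rw [h, h0]
  · rw [Finsupp.onFinset_apply, Nat.toPNat'_coe, if_pos (show 0 < n by omega)]
    split_ifs with h'
    · rfl
    · exact (hN j n (by omega)).symm

theorem extendZero_endEdges (t : ℕ) (j : Fin 2) (n : ℕ) :
    extendZero (truncMonomial (4 * t + 2) (endEdges t)) j n = endEdges t j n := by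
  apply extendZero_truncMonomial <;> grind [endEdges]

theorem extendZero_endCherries (t : ℕ) (j : Fin 2) (n : ℕ) :
    extendZero (truncMonomial (4 * t + 2) (endCherries t)) j n = endCherries t j n := by
  apply extendZero_truncMonomial <;> grind [endCherries]

theorem expMap_endCherries {t : ℕ} (ht : 0 < t) :
    expMap (truncMonomial (4 * t + 2) (endCherries t)) =
      expMap (truncMonomial (4 * t + 2) (endEdges t)) := by
  ext i
  have hi := i.pos
  simp only [expMap_apply, extendZero_endCherries, extendZero_endEdges]
  simp only [endCherries, endEdges, if_true, one_ne_zero, if_false]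
  generalize (i : ℕ) = n at *
  grind

theorem endEdges_fibre {t : ℕ} (ht : 0 < t) (a b : ℕ → ℕ) (ha0 : a 0 = 0) (hb0 : b 0 = 0)
    (h : ∀ n, 0 < n → a n + b n + a (n - 1) + b (n - 2) =
      endEdges t 0 n + endEdges t 1 n + endEdges t 0 (n - 1) + endEdges t 1 (n - 2)) :
    (∀ n, a n = endEdges t 0 n ∧ b n = endEdges t 1 n) ∨
      ∀ n, (endEdges t 0 n = 0 ∨ a n = 0) ∧ (endEdges t 1 n = 0 ∨ b n = 0) := by
  simp only [endEdges, if_true, one_ne_zero, if_false] at h ⊢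
  have hzero : ∀ n, 4 ≤ n → n % 2 = 0 → n ≠ 4 * t + 2 →
      a n = 0 ∧ b n = 0 ∧ a (n - 1) = 0 ∧ b (n - 2) = 0 := by
    intro n h4 h2 hne
    have := h n (by omega)
    grind
  have hzero' : ∀ n, 4 * t + 4 ≤ n → a n = 0 ∧ b n = 0 ∧ a (n - 1) = 0 ∧ b (n - 2) = 0 := by
    intro n h4
    have := h n (by omega)
    split_ifs at this <;> omega
  have e1 : a 1 + b 1 = 1 := by have := h 1 (by omega); grind
  have b2 : b 2 = 0 := (hzero 4 (by omega) (by omega) (by omega)).2.2.2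
  have e2 : a 1 + a 2 = 1 := by have := h 2 (by omega); grind
  have a3 : a 3 = 0 := (hzero 4 (by omega) (by omega) (by omega)).2.2.1
  have e3 : b 3 = 2 * a 1 := by have := h 3 (by omega); grind
  have hstep : ∀ n, 5 ≤ n → n % 2 = 1 → n < 4 * t + 1 → b n + b (n - 2) = 2 := by
    intro n h5 h2 hn
    have h1 := h n (by omega)
    have h3 := (hzero (n + 1) (by omega) (by omega) (by omega)).2.2.1
    have h4 := (hzero (n - 1) (by omega) (by omega) (by omega)).1
    rw [Nat.add_sub_cancel] at h3
    grind
  have hpath : ∀ j, j < t → b (4 * j + 3) = 2 * a 1 := by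
    intro j
    induction j with
    | zero => intro _; exact e3
    | succ j ih =>
      intro hj
      have h1 := ih (by omega)
      have h2 := hstep (4 * j + 5) (by omega) (by omega) (by omega)
      have h3 := hstep (4 * j + 7) (by omega) (by omega) (by omega)
      rw [show 4 * j + 5 - 2 = 4 * j + 3 by omega] at h2
      rw [show 4 * j + 7 - 2 = 4 * j + 5 by omega] at h3
      rw [show 4 * (j + 1) + 3 = 4 * j + 7 by omega]
      omega
  have hpath3 : ∀ n, n % 4 = 3 → n < 4 * t + 1 → b n = 2 * a 1 := by
    intro n h3 hn
    have := hpath (n / 4) (by omega)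
    rwa [show 4 * (n / 4) + 3 = n by omega] at this
  have hpath1 : ∀ n, n % 4 = 1 → 1 < n → n < 4 * t + 1 → b n + 2 * a 1 = 2 := by
    intro n h1 h2 hn
    have h3 := hstep n (by omega) (by omega) hn
    have h4 := hpath3 (n - 2) (by omega) (by omega)
    omega
  have z1 := hzero (4 * t) (by omega) (by omega) (by omega)
  have z3 := hzero (4 * t + 4) (by omega) (by omega) (by omega)
  have z4 := hzero' (4 * t + 5) (by omega)
  rw [show 4 * t + 4 - 1 = 4 * t + 3 by omega, show 4 * t + 4 - 2 = 4 * t + 2 by omega] at z3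
  rw [show 4 * t + 5 - 1 = 4 * t + 4 by omega, show 4 * t + 5 - 2 = 4 * t + 3 by omega] at z4
  have f1 := h (4 * t + 1) (by omega)
  have f2 := h (4 * t + 2) (by omega)
  have f3 := h (4 * t + 3) (by omega)
  have l1 := hpath3 (4 * t - 1) (by omega) (by omega)
  rw [show 4 * t + 1 - 1 = 4 * t by omega, show 4 * t + 1 - 2 = 4 * t - 1 by omega] at f1
  rw [show 4 * t + 2 - 1 = 4 * t + 1 by omega, show 4 * t + 2 - 2 = 4 * t by omega] at f2
  rw [show 4 * t + 3 - 1 = 4 * t + 2 by omega, show 4 * t + 3 - 2 = 4 * t + 1 by omega] at f3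
  have hodd : ∀ n, 3 ≤ n → n % 2 = 1 → n < 4 * t + 1 → a n = 0 := by
    intro n h3 h2 hn
    simpa using (hzero (n + 1) (by omega) (by omega) (by omega)).2.2.1
  have hcases : ∀ n, n = 0 ∨ n = 1 ∨ n = 2 ∨ n = 3 ∨ (5 ≤ n ∧ n % 4 = 1 ∧ n < 4 * t + 1) ∨
      (5 ≤ n ∧ n % 4 = 3 ∧ n < 4 * t + 1) ∨ (4 ≤ n ∧ n % 2 = 0 ∧ n ≠ 4 * t + 2) ∨
      n = 4 * t + 1 ∨ n = 4 * t + 2 ∨ n = 4 * t + 3 ∨ 4 * t + 4 ≤ n := by omega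
  rw [if_neg (by omega), if_neg (by omega), if_neg (by omega), if_pos (by omega)] at f1
  rw [if_pos (by omega), if_neg (by omega), if_neg (by omega), if_neg (by omega)] at f2
  rw [if_neg (by omega), if_neg (by omega), if_pos (by omega), if_neg (by omega)] at f3
  clear h hstep hpath
  have a_first : a (4 * t + 1) + a 1 = 1 := by omega
  have a_last : a (4 * t + 2) = a 1 := by omega
  have hA : ∀ n, n ≠ 1 → n ≠ 2 → n ≠ 4 * t + 1 → n ≠ 4 * t + 2 → a n = 0 := by
    intro n _ _ _ _
    rcases hcases n with h | h | h | h | h | h | h | h | h | h | h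
    · rw [h, ha0]
    · omega
    · omega
    · rw [h, a3]
    · exact hodd n (by omega) (by omega) (by omega)
    · exact hodd n (by omega) (by omega) (by omega)
    · exact (hzero n h.1 h.2.1 h.2.2).1
    · omega
    · omega
    · rw [h, z3.2.2.1]
    · exact (hzero' n h).1
  have hB : ∀ n, ¬(n % 4 = 3 ∧ n < 4 * t + 1) → a 1 = 1 → b n = 0 := by
    intro n hn h1
    rcases hcases n with h | h | h | h | h | h | h | h | h | h | h
    · rw [h, hb0]
    · rw [h]; omega
    · rw [h, b2]
    · omega
    · have := hpath1 n (by omega) (by omega) (by omega)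
      omega
    · omega
    · exact (hzero n h.1 h.2.1 h.2.2).2.1
    · rw [h]; omega
    · rw [h, z3.2.2.2]
    · rw [h, z4.2.2.2]
    · exact (hzero' n h).2.1
  clear hcases hzero hzero' hodd hpath1 f1 f2 f3 z1 z3 z4
  have h01 : a 1 = 0 ∨ a 1 = 1 := by omega
  rcases h01 with h1 | h1
  · refine Or.inr fun n => ⟨?_, ?_⟩
    · split_ifs with h
      · rcases h with rfl | rfl
        · exact Or.inr h1
        · omega
      · exact Or.inl rfl
    · split_ifs with h
      · have := hpath3 n h.1 h.2
        omega
      · exact Or.inl rfl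
  · refine Or.inl fun n => ⟨?_, ?_⟩
    · split_ifs with h
      · rcases h with rfl | rfl
        · exact h1
        · omega
      · rw [not_or] at h
        by_cases h2 : n = 2
        · rw [h2]; omega
        by_cases h3 : n = 4 * t + 1
        · rw [h3]; omega
        exact hA n h.1 h2 h3 h.2
    · split_ifs with h
      · have := hpath3 n h.1 h.2
        omega
      · exact hB n h h1

/-- `I = ker φ` is not finitely generated up to shift: there is no finite `F ⊆ I`
such that `I` is generated by the shifts `sh_k(f)`, `f ∈ F`, `k ≥ 0`. -/
theorem stmt14 (K : Type*) [Field K] :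
    ¬ ∃ F : Finset (MvPolynomial (Fin 2 × ℕ+) K),
        (∀ f ∈ F, f ∈ RingHom.ker (phi K)) ∧
        Ideal.span {g | ∃ f ∈ F, ∃ k : ℕ, g = sh K k f} = RingHom.ker (phi K) := by
  rintro ⟨F, -, hF⟩
  obtain ⟨N, hN⟩ : ∃ N : ℕ, ∀ f ∈ F, ∀ p ∈ f.vars, (p.2 : ℕ) ≤ N := by
    classical
    refine ⟨(F.biUnion vars).sup fun p => (p.2 : ℕ), fun f hf p hp => ?_⟩
    exact Finset.le_sup (f := fun p : Fin 2 × ℕ+ => (p.2 : ℕ))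
      (Finset.mem_biUnion.2 ⟨f, hf, hp⟩)
  set t := N + 1 with ht
  set m := truncMonomial (4 * t + 2) (endEdges t) with hm
  set m' := truncMonomial (4 * t + 2) (endCherries t) with hm'
  have hm0 : ∀ i : ℕ+, m (0, i) = endEdges t 0 i := fun i => by
    rw [← extendZero_coe, hm, extendZero_endEdges]
  have hfib : ∀ w, expMap w = expMap m → w = m ∨ ∀ p, m p = 0 ∨ w p = 0 := by
    intro w hw
    have key := endEdges_fibre (t := t) (by omega) (extendZero w 0) (extendZero w 1)
      (by simp [extendZero]) (by simp [extendZero]) (by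
        intro n hn
        have := DFunLike.congr_fun hw n.toPNat'
        simpa only [expMap_apply, hm, extendZero_endEdges, Nat.toPNat'_coe, if_pos hn] using this)
    simp only [← extendZero_endEdges, ← hm] at key
    refine key.imp (fun h => ?_) fun h => ?_
    · ext ⟨j, n⟩
      have := h n
      fin_cases j
      · simpa [extendZero_coe] using this.1
      · simpa [extendZero_coe] using this.2
    · rintro ⟨j, n⟩
      have := h n
      fin_cases j
      · simpa [extendZero_coe] using this.1
      · simpa [extendZero_coe] using this.2
  have hne : m' ≠ m := by
    intro h
    have h1 := extendZero_endCherries t 0 1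
    rw [← hm', h, hm, extendZero_endEdges] at h1
    simp [endEdges, endCherries] at h1
  have hker : (monomial m (1 : K) - monomial m' 1) ∈ RingHom.ker (phi K) := by
    rw [RingHom.mem_ker, map_sub, phi_monomial, phi_monomial, hm', expMap_endCherries (by omega),
      sub_self]
  have hshift : ∀ f ∈ F, ∀ k, coeff m (sh K k f) = 0 := by
    intro f hf k
    by_contra hc
    rw [sh_eq_rename] at hc
    obtain ⟨u, hu, huf⟩ := coeff_rename_ne_zero _ _ _ hc
    have hex : ∀ p, m p ≠ 0 → ∃ q ∈ f.vars, q.2 + k = (p.2 : ℕ) := by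
      intro p hp
      rw [← hu, ← Finsupp.mem_support_iff] at hp
      classical
      obtain ⟨q, hq, rfl⟩ := Finset.mem_image.1 (Finsupp.mapDomain_support hp)
      refine ⟨q, (mem_vars_iff_mem_support q).2 ⟨u, mem_support_iff.2 huf, hq⟩, ?_⟩
      exact (Nat.toPNat'_coe _).trans (if_pos (Nat.add_pos_left q.2.pos k)) |>.symm
    obtain ⟨q, hq, hqk⟩ := hex (0, 1) (by simp [hm0, endEdges])
    obtain ⟨r, hr, hrk⟩ := hex (0, (4 * t + 1).succPNat) (by simp [hm0, endEdges])
    have := hN f hf r hr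
    have := q.2.pos
    simp only [PNat.one_coe, Nat.succPNat_coe] at hqk hrk
    omega
  have hspan : ∀ g ∈ Ideal.span {g | ∃ f ∈ F, ∃ k : ℕ, g = sh K k f}, coeff m g = 0 := by
    intro g hg
    induction hg using Submodule.span_induction with
    | mem g hg =>
      obtain ⟨f, hf, k, rfl⟩ := hg
      exact hshift f hf k
    | zero => simp
    | add x y _ _ hx hy => rw [coeff_add, hx, hy, add_zero]
    | smul q x hx hxm =>
      rw [← Ideal.span, hF] at hx
      exact coeff_mul_eq_zero_of_mem_ker hx m hfib hxm q
  have := hspan _ (hF ▸ hker)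
  rw [coeff_sub, coeff_monomial, coeff_monomial, if_pos rfl, if_neg hne, sub_zero] at this
  exact one_ne_zero this
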